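/- Let −3 < γ ≤ 1, α ≥ 0, β₂ ∈ ℝ, and 2 ≤ p₁ < ∞ with p₁/(p₁ − 1) < min{3, 3/|γ|} (with the convention min{3, 3/|γ|} = 3 when γ = 0). Let k : ℝ³ × ℝ³ → ℝ be a measurable kernel such that the conjugated kernel k_α(v, v_*) := e^{α|v|²} k(v, v_*) e^{−α|v_*|²} satisfies, for some constants C₀ > 0 and α₁, α₂, α₃ > 0 and all v ≠ v_*, |k_α(v, v_*)| ≤ C₀ w_γ(|v − v_*|) (1 + |v| + |v_*|)^{γ−1} e^{−α₁ |v − v_*|²} e^{−α₃ ((v − v_*)·v/|v − v_*| − α₂ |v − v_*|)²}. Set β₃ = β₂ + 2 − γ − 1/p₁. Then there exists a constant C > 0 such that for every measurable h : ℝ³ → ℝ and almost every v ∈ ℝ³, |∫_{ℝ³} k(v, v_*) h(v_*) dv_*| e^{α|v|²} (1 + |v|)^{β₃} ≤ C ( ∫_{ℝ³} |h(v_*)|^{p₁} e^{p₁ α |v_*|²} (1 + |v_*|)^{p₁ β₂} dv_* )^{1/p₁}. -/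

import Mathlib

open MeasureTheory Real Set
open scoped ENNReal RealInnerProductSpace

noncomputable section

/-- `ℝ³` as a Euclidean space. -/
abbrev E3 : Type := EuclideanSpace ℝ (Fin 3)

/-- The singular weight `w_γ`. -/
def wGamma (γ r : ℝ) : ℝ :=
  if -1 < γ then 1 / r
  else if γ = -1 then (|Real.log r| + 1) / r
  else 1 / r ^ |γ|

/-- `min {3, 3/|γ|}`, with the convention that it equals `3` when `γ = 0`. -/
def minExp (γ : ℝ) : ℝ := if γ = 0 then 3 else min 3 (3 / |γ|)

/-- Integration in polar coordinates in the plane, as an iterated integral. -/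
lemma lintegral_polar {f : ℝ × ℝ → ℝ≥0∞} (hf : Measurable f) :
    ∫⁻ p, f p = ∫⁻ r in Ioi (0 : ℝ), ∫⁻ θ in Ioo (-π) π,
      ENNReal.ofReal r * f (r * cos θ, r * sin θ) := by
  rw [← lintegral_comp_polarCoord_symm, polarCoord_target, Measure.volume_eq_prod,
    setLIntegral_prod _ (by simp only [smul_eq_mul, polarCoord_symm_apply]; fun_prop)]
  simp only [smul_eq_mul, polarCoord_symm_apply]

/-- The substitution `t = cos θ`. -/
lemma lintegral_sin_mul_comp_cos (g : ℝ → ℝ≥0∞) :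
    ∫⁻ θ in Ioo (-π) π, ENNReal.ofReal (sin θ) * g (cos θ) = ∫⁻ t in Icc (-1) 1, g t := by
  have h1 := lintegral_image_eq_lintegral_abs_deriv_mul (s := Icc 0 π) measurableSet_Icc
    (fun x _ => (hasDerivAt_cos x).hasDerivWithinAt) injOn_cos g
  rw [bijOn_cos.image_eq] at h1
  rw [h1, ← setLIntegral_congr (Ioo_ae_eq_Icc (μ := volume) (a := (0 : ℝ)) (b := π))]
  have hsub : Ioo 0 π ⊆ Ioo (-π) π := Ioo_subset_Ioo_left (by linarith [pi_pos])
  have h2 : ∀ θ ∈ Ioo (-π) π, ENNReal.ofReal (sin θ) * g (cos θ) =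
      (Ioo 0 π).indicator (fun θ => ENNReal.ofReal |-sin θ| * g (cos θ)) θ := by
    intro θ hθ
    by_cases h : 0 < θ
    · rw [indicator_of_mem (show θ ∈ Ioo 0 π from ⟨h, hθ.2⟩), abs_neg,
        abs_of_pos (sin_pos_of_mem_Ioo ⟨h, hθ.2⟩)]
    · rw [indicator_of_notMem (fun h' => h h'.1), ENNReal.ofReal_of_nonpos
        (sin_nonpos_of_nonpos_of_neg_pi_le (not_lt.1 h) hθ.1.le), zero_mul]
  rw [setLIntegral_congr_fun measurableSet_Ioo h2, setLIntegral_indicator measurableSet_Ioo,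
    inter_eq_left.2 hsub]

/-- A function of `z` and the distance to the `z`-axis, integrated over `ℝ × ℝ²`. -/
lemma lintegral_cylindrical {H : ℝ × ℝ → ℝ≥0∞} (hH : Measurable H) (a : ℝ) :
    ∫⁻ x : ℝ × (ℝ × ℝ), H (√(x.1 ^ 2 + (x.2.1 ^ 2 + x.2.2 ^ 2)),
        a * x.1 / √(x.1 ^ 2 + (x.2.1 ^ 2 + x.2.2 ^ 2))) =
      ENNReal.ofReal (2 * π) * ∫⁻ r in Ioi (0 : ℝ), ENNReal.ofReal (r ^ 2) *
        ∫⁻ t in Icc (-1) 1, H (r, a * t) := by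
  rw [Measure.volume_eq_prod, lintegral_prod _ (by fun_prop)]
  have h1 (z : ℝ) : ∫⁻ y : ℝ × ℝ, H (√(z ^ 2 + (y.1 ^ 2 + y.2 ^ 2)),
        a * z / √(z ^ 2 + (y.1 ^ 2 + y.2 ^ 2))) =
      ENNReal.ofReal (2 * π) * ∫⁻ ρ, ENNReal.ofReal ρ *
        H (√(z ^ 2 + ρ ^ 2), a * z / √(z ^ 2 + ρ ^ 2)) := by
    rw [lintegral_polar (by fun_prop)]
    have (r θ : ℝ) : (r * cos θ) ^ 2 + (r * sin θ) ^ 2 = r ^ 2 := by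
      linear_combination r ^ 2 * sin_sq_add_cos_sq θ
    simp only [this, lintegral_const, Measure.restrict_apply_univ, Real.volume_Ioo]
    rw [show π - -π = 2 * π by ring, ← lintegral_const_mul _ (by fun_prop),
      ← lintegral_indicator measurableSet_Ioi]
    refine lintegral_congr fun ρ => ?_
    by_cases h : 0 < ρ
    · rw [indicator_of_mem (show ρ ∈ Ioi 0 from h), mul_comm]
    · rw [indicator_of_notMem (by simpa using h), ENNReal.ofReal_of_nonpos (not_lt.1 h)]
      simp
  simp only [h1]
  rw [lintegral_const_mul _ (by fun_prop)]
  congr 1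
  rw [← lintegral_prod (f := fun p : ℝ × ℝ => ENNReal.ofReal p.2 *
        H (√(p.1 ^ 2 + p.2 ^ 2), a * p.1 / √(p.1 ^ 2 + p.2 ^ 2))) (by fun_prop),
    ← Measure.volume_eq_prod, lintegral_polar (by fun_prop)]
  refine setLIntegral_congr_fun measurableSet_Ioi fun r (hr : 0 < r) => ?_
  have (θ : ℝ) : √((r * cos θ) ^ 2 + (r * sin θ) ^ 2) = r := by
    rw [← sqrt_sq hr.le]
    congr 1
    rw [sqrt_sq hr.le]
    linear_combination r ^ 2 * sin_sq_add_cos_sq θ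
  simp only [this]
  rw [← lintegral_sin_mul_comp_cos (fun t => H (r, a * t)), ← lintegral_const_mul _ (by fun_prop)]
  congr 1 with θ
  rw [ENNReal.ofReal_mul hr.le, sq, ENNReal.ofReal_mul hr.le,
    show a * (r * cos θ) / r = a * cos θ by field_simp]
  ring

/-- Spherical coordinates on `ℝ³` with polar axis `v`, for functions that depend only on the radius
and on the component along `v`. -/
lemma lintegral_radial_axial {H : ℝ × ℝ → ℝ≥0∞} (hH : Measurable H) {v : E3} (hv : v ≠ 0) :
    ∫⁻ u : E3, H (‖u‖, ⟪u, v⟫ / ‖u‖) =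
      ENNReal.ofReal (2 * π) * ∫⁻ r in Ioi (0 : ℝ), ENNReal.ofReal (r ^ 2) *
        ∫⁻ t in Icc (-1) 1, H (r, ‖v‖ * t) := by
  obtain ⟨b, hb⟩ := Orthonormal.exists_orthonormalBasis_extension_of_card_eq (𝕜 := ℝ) (E := E3)
    (ι := Fin 3) (by simp) (v := fun _ => ‖v‖⁻¹ • v) (s := {0}) (by
      rw [orthonormal_subsingleton_iff]
      intro i
      simp [norm_smul, hv])
  have hb0 : v = ‖v‖ • b 0 := by
    rw [hb 0 rfl, smul_smul, mul_inv_cancel₀ (norm_ne_zero_iff.2 hv), one_smul]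
  rw [← lintegral_cylindrical hH]
  rw [← b.measurePreserving_repr_symm.lintegral_comp_emb
    b.repr.symm.toHomeomorph.measurableEmbedding]
  rw [← (PiLp.volume_preserving_toLp (Fin 3)).lintegral_comp_emb
    (MeasurableEquiv.toLp 2 _).measurableEmbedding]
  rw [← (volume_preserving_piFinSuccAbove (fun _ : Fin 3 => ℝ) 0).symm.lintegral_comp_emb
    (MeasurableEquiv.measurableEmbedding _)]
  have hmp : MeasurePreserving
      ((MeasurableEquiv.refl ℝ).prodCongr MeasurableEquiv.finTwoArrow.symm) volume volume :=
    (MeasurePreserving.id (volume : Measure ℝ)).prod (volume_preserving_finTwoArrow ℝ).symm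
  rw [← hmp.lintegral_comp_emb (MeasurableEquiv.measurableEmbedding _)]
  refine lintegral_congr fun x => ?_
  set w : Fin 3 → ℝ := (MeasurableEquiv.piFinSuccAbove (fun _ : Fin 3 => ℝ) 0).symm
    ((MeasurableEquiv.refl ℝ).prodCongr MeasurableEquiv.finTwoArrow.symm x) with hw
  have hw0 : w 0 = x.1 := rfl
  have hw1 : w 1 = x.2.1 := rfl
  have hw2 : w 2 = x.2.2 := rfl
  have hn : ‖b.repr.symm (WithLp.toLp 2 w)‖ = √(x.1 ^ 2 + (x.2.1 ^ 2 + x.2.2 ^ 2)) := by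
    rw [LinearIsometryEquiv.norm_map, EuclideanSpace.norm_eq, Fin.sum_univ_three]
    simp only [hw0, hw1, hw2, norm_eq_abs, sq_abs, add_assoc]
  have hi : ⟪b.repr.symm (WithLp.toLp 2 w), v⟫ = ‖v‖ * x.1 := by
    conv_lhs => rw [hb0]
    rw [inner_smul_right, real_inner_comm, ← b.repr_apply_apply,
      LinearIsometryEquiv.apply_symm_apply, ← hw0]
  rw [hn, hi]

/-- A Gaussian in `a * t - b` has mass `O(1 / (1 + a))` on `[-1, 1]`, uniformly in `b`. -/
lemma lintegral_Icc_gaussian_le {a c : ℝ} (ha : 0 < a) (hc : 0 < c) (b : ℝ) :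
    ∫⁻ t in Icc (-1) 1, ENNReal.ofReal (exp (-c * (a * t - b) ^ 2)) ≤
      ENNReal.ofReal ((4 + 2 * √(π / c)) / (1 + a)) := by
  rcases le_total a 1 with h | h
  · calc ∫⁻ t in Icc (-1) 1, ENNReal.ofReal (exp (-c * (a * t - b) ^ 2))
        ≤ ∫⁻ t in Icc (-1 : ℝ) 1, 1 := by
          refine lintegral_mono fun t => ENNReal.ofReal_le_one.2 (exp_le_one_iff.2 ?_)
          nlinarith [sq_nonneg (a * t - b)]
      _ = ENNReal.ofReal 2 := by
          rw [setLIntegral_one, Real.volume_Icc]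
          norm_num
      _ ≤ _ := by
          refine ENNReal.ofReal_le_ofReal ?_
          rw [le_div_iff₀ (by linarith)]
          nlinarith [sqrt_nonneg (π / c)]
  · have hfun : (fun t => exp (-c * (a * t - b) ^ 2)) =
        fun t => (fun y => (fun x => exp (-c * x ^ 2)) (y - b)) (a * t) := rfl
    have hint : Integrable fun t => exp (-c * (a * t - b) ^ 2) := by
      rw [hfun]
      exact ((integrable_exp_neg_mul_sq hc).comp_sub_right b).comp_mul_left' ha.ne'
    calc ∫⁻ t in Icc (-1) 1, ENNReal.ofReal (exp (-c * (a * t - b) ^ 2))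
        ≤ ∫⁻ t, ENNReal.ofReal (exp (-c * (a * t - b) ^ 2)) := setLIntegral_le_lintegral _ _
      _ = ENNReal.ofReal (∫ t, exp (-c * (a * t - b) ^ 2)) :=
          (ofReal_integral_eq_lintegral_ofReal hint
            (Filter.Eventually.of_forall fun t => (exp_pos _).le)).symm
      _ = ENNReal.ofReal (a⁻¹ * √(π / c)) := by
          rw [Measure.integral_comp_mul_left (fun y => exp (-c * (y - b) ^ 2)),
            integral_sub_right_eq_self (fun x => exp (-c * x ^ 2)), integral_gaussian, smul_eq_mul, abs_of_pos (inv_pos.2 ha)]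
      _ ≤ _ := by
          refine ENNReal.ofReal_le_ofReal ?_
          rw [inv_mul_eq_div, div_le_div_iff₀ ha (by linarith)]
          nlinarith [sqrt_nonneg (π / c)]

lemma wGamma_nonneg (γ : ℝ) {r : ℝ} (hr : 0 ≤ r) : 0 ≤ wGamma γ r := by
  unfold wGamma
  split_ifs <;> positivity

@[fun_prop]
lemma measurable_wGamma (γ : ℝ) : Measurable (wGamma γ) := by
  unfold wGamma
  split_ifs <;> fun_prop

/-- `w_γ` is dominated by a power `r ^ (-s)` with `s * q < 3`, up to polynomial growth. -/
lemma wGamma_le_rpow {γ q : ℝ} (hq2 : q ≤ 2) (hq : q < minExp γ) :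
    ∃ C > 0, ∃ s : ℝ, s * q < 3 ∧ ∀ r > 0, wGamma γ r ≤ C * r ^ (-s) * (1 + r) ^ (2 : ℝ) := by
  have hq3 : q < 3 := by linarith
  have one_le {r : ℝ} (hr : 0 < r) : 1 ≤ (1 + r) ^ (2 : ℝ) :=
    one_le_rpow (by linarith) (by norm_num)
  rcases lt_trichotomy (-1) γ with h | h | h
  · refine ⟨1, one_pos, 1, by linarith, fun r hr => ?_⟩
    rw [wGamma, if_pos h, one_mul, rpow_neg_one, one_div]
    exact le_mul_of_one_le_right (by positivity) (one_le hr)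
  · refine ⟨5, by norm_num, 5 / 4, by linarith, fun r hr => ?_⟩
    rw [wGamma, if_neg (by linarith), if_pos h.symm]
    have hsplit : r ^ (-(5 / 4) : ℝ) = (r ^ (1 / 4 : ℝ))⁻¹ * r⁻¹ := by
      rw [← rpow_neg hr.le, ← rpow_neg_one, ← rpow_add hr]
      norm_num
    have hr4 : 0 < r ^ (1 / 4 : ℝ) := by positivity
    have key : (|log r| + 1) * r ^ (1 / 4 : ℝ) ≤ 5 * (1 + r) ^ (2 : ℝ) := by
      rcases le_total r 1 with h1 | h1
      · have h2 := abs_log_mul_self_rpow_lt r (1 / 4) hr h1 (by norm_num)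
        rw [abs_mul, abs_of_pos hr4] at h2
        have h3 : r ^ (1 / 4 : ℝ) ≤ 1 := rpow_le_one hr.le h1 (by norm_num)
        have := one_le hr
        norm_num at h2 this ⊢
        nlinarith
      · have h2 : |log r| ≤ r := by
          rw [abs_of_nonneg (log_nonneg h1)]
          linarith [log_le_sub_one_of_pos hr]
        have h3 : r ^ (1 / 4 : ℝ) ≤ r := by
          simpa using rpow_le_rpow_of_exponent_le h1 (show (1 / 4 : ℝ) ≤ 1 by norm_num)
        rw [rpow_two]
        calc (|log r| + 1) * r ^ (1 / 4 : ℝ) ≤ (r + 1) * r := by gcongr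
          _ ≤ 5 * (1 + r) ^ 2 := by nlinarith
    rw [hsplit, div_le_iff₀ hr]
    calc |log r| + 1 = (|log r| + 1) * r ^ (1 / 4 : ℝ) * (r ^ (1 / 4 : ℝ))⁻¹ := by field_simp
      _ ≤ 5 * (1 + r) ^ (2 : ℝ) * (r ^ (1 / 4 : ℝ))⁻¹ := by gcongr
      _ = _ := by field_simp
  · refine ⟨1, one_pos, |γ|, ?_, fun r hr => ?_⟩
    · rw [minExp, if_neg (by linarith)] at hq
      have hγ : 0 < |γ| := abs_pos.2 (by linarith)
      have := hq.trans_le (min_le_right _ _)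
      rwa [lt_div_iff₀ hγ, mul_comm] at this
    · rw [wGamma, if_neg (by linarith), if_neg (by linarith), one_mul, rpow_neg hr.le, one_div]
      exact le_mul_of_one_le_right (by positivity) (one_le hr)

lemma one_add_rpow_le {r M : ℝ} (hr : 0 ≤ r) (hM : 0 ≤ M) :
    (1 + r) ^ M ≤ 2 ^ M * (1 + r ^ M) := by
  have h0 : 0 ≤ r ^ M := by positivity
  rcases le_total r 1 with h | h
  · calc (1 + r) ^ M ≤ 2 ^ M := by gcongr; linarith
      _ ≤ _ := le_mul_of_one_le_right (by positivity) (by linarith)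
  · calc (1 + r) ^ M ≤ (2 * r) ^ M := by gcongr; linarith
      _ = 2 ^ M * r ^ M := mul_rpow (by norm_num) hr
      _ ≤ _ := by gcongr; linarith

/-- The radial part of the kernel bound is `L^q` on `ℝ³`. -/
lemma lintegral_wGamma_rpow_lt_top {γ q m b : ℝ} (hq0 : 0 < q) (hq2 : q ≤ 2)
    (hq : q < minExp γ) (hm : 0 ≤ m) (hb : 0 < b) :
    ∫⁻ r in Ioi (0 : ℝ), ENNReal.ofReal (r ^ 2) *
      ENNReal.ofReal ((wGamma γ r * (1 + r) ^ m * exp (-b * r ^ 2)) ^ q) < ∞ := by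
  obtain ⟨C, hC, s, hs, hw⟩ := wGamma_le_rpow hq2 hq
  have hbq : 0 < b * q := by positivity
  have hM : 0 ≤ (2 + m) * q := by positivity
  have hint := ((integrableOn_rpow_mul_exp_neg_mul_sq hbq (s := 2 - s * q) (by linarith)).add
    (integrableOn_rpow_mul_exp_neg_mul_sq hbq (s := 2 - s * q + (2 + m) * q)
      (by linarith))).const_mul (C ^ q * 2 ^ ((2 + m) * q))
  refine lt_of_le_of_lt (setLIntegral_mono' measurableSet_Ioi fun r (hr : 0 < r) => ?_)
    hint.lintegral_lt_top
  rw [← ENNReal.ofReal_mul (by positivity)]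
  refine ENNReal.ofReal_le_ofReal ?_
  have hw0 := wGamma_nonneg γ hr.le
  have he : exp (-b * r ^ 2) ^ q = exp (-(b * q) * r ^ 2) := by
    rw [← exp_mul]
    ring_nf
  calc r ^ 2 * (wGamma γ r * (1 + r) ^ m * exp (-b * r ^ 2)) ^ q
      ≤ r ^ 2 * (C * r ^ (-s) * (1 + r) ^ (2 : ℝ) * (1 + r) ^ m * exp (-b * r ^ 2)) ^ q := by
        gcongr
        exact hw r hr
    _ = r ^ 2 * (C * r ^ (-s) * (1 + r) ^ (2 + m) * exp (-b * r ^ 2)) ^ q := by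
        rw [mul_assoc (C * r ^ (-s)), ← rpow_add (by linarith)]
    _ = C ^ q * (r ^ (2 : ℝ) * r ^ (-s * q)) * (1 + r) ^ ((2 + m) * q) *
          exp (-(b * q) * r ^ 2) := by
        rw [mul_rpow (by positivity) (by positivity), mul_rpow (by positivity) (by positivity),
          mul_rpow (by positivity) (by positivity), he, rpow_mul hr.le, rpow_mul (by positivity),
          rpow_two]
        ring
    _ ≤ C ^ q * r ^ (2 - s * q) * (2 ^ ((2 + m) * q) * (1 + r ^ ((2 + m) * q))) *
          exp (-(b * q) * r ^ 2) := by
        rw [← rpow_add hr, neg_mul, ← sub_eq_add_neg]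
        gcongr
        exact one_add_rpow_le hr.le hM
    _ = _ := by
        simp only [Pi.add_apply]
        rw [rpow_add hr]
        ring

/-- Peetre's inequality in multiplicative form. -/
lemma rpow_le_rpow_mul_rpow_abs {x y z : ℝ} (hx : 0 < x) (hy : 0 < y) (hz : 0 < z)
    (hxy : x ≤ y * z) (hyx : y ≤ x * z) (β : ℝ) : x ^ β ≤ y ^ β * z ^ |β| := by
  rcases le_total 0 β with h | h
  · rw [abs_of_nonneg h, ← mul_rpow hy.le hz.le]
    gcongr
  · rw [abs_of_nonpos h, rpow_neg hz.le, ← div_eq_mul_inv, ← div_rpow hy.le hz.le]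
    exact rpow_le_rpow_of_nonpos (by positivity) ((div_le_iff₀ hz).2 hyx) h

/-- The `q`-th power of the translated kernel bound integrates to `O(1 / (1 + |v|))`. -/
lemma exists_lintegral_kernel_le {γ q m b c : ℝ} (α₂ : ℝ) (hq0 : 0 < q) (hq2 : q ≤ 2)
    (hq : q < minExp γ) (hm : 0 ≤ m) (hb : 0 < b) (hc : 0 < c) :
    ∃ D > 0, ∀ v : E3, v ≠ 0 →
      ∫⁻ u : E3, ENNReal.ofReal ((wGamma γ ‖u‖ * (1 + ‖u‖) ^ m * exp (-b * ‖u‖ ^ 2) *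
        exp (-c * (⟪u, v⟫ / ‖u‖ - α₂ * ‖u‖) ^ 2)) ^ q) ≤ ENNReal.ofReal (D / (1 + ‖v‖)) := by
  have hI := lintegral_wGamma_rpow_lt_top hq0 hq2 hq hm hb
  set I := ∫⁻ r in Ioi (0 : ℝ), ENNReal.ofReal (r ^ 2) *
    ENNReal.ofReal ((wGamma γ r * (1 + r) ^ m * exp (-b * r ^ 2)) ^ q) with hIdef
  have hcq : 0 < c * q := by positivity
  set M := 4 + 2 * √(π / (c * q)) with hM
  have hMpos : 0 < M := by positivity
  refine ⟨2 * π * ((I.toReal + 1) * M), by positivity, fun v hv => ?_⟩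
  let H : ℝ × ℝ → ℝ≥0∞ := fun p =>
    ENNReal.ofReal ((wGamma γ p.1 * (1 + p.1) ^ m * exp (-b * p.1 ^ 2)) ^ q) *
      ENNReal.ofReal (exp (-(c * q) * (p.2 - α₂ * p.1) ^ 2))
  have hH : Measurable H := by fun_prop
  calc _ = ∫⁻ u : E3, H (‖u‖, ⟪u, v⟫ / ‖u‖) := by
        refine lintegral_congr fun u => ?_
        have hw := wGamma_nonneg γ (norm_nonneg u)
        simp only [H]
        rw [← ENNReal.ofReal_mul (by positivity), mul_rpow (by positivity) (by positivity),
          ← exp_mul]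
        ring_nf
    _ = ENNReal.ofReal (2 * π) * ∫⁻ r in Ioi (0 : ℝ), ENNReal.ofReal (r ^ 2) *
          ∫⁻ t in Icc (-1) 1, H (r, ‖v‖ * t) := lintegral_radial_axial hH hv
    _ ≤ ENNReal.ofReal (2 * π) * (I * ENNReal.ofReal (M / (1 + ‖v‖))) := by
        gcongr
        rw [hIdef, ← lintegral_mul_const _ (by fun_prop)]
        refine lintegral_mono fun r => ?_
        simp only [H]
        rw [lintegral_const_mul _ (by fun_prop), ← mul_assoc (ENNReal.ofReal (r ^ 2))]
        gcongr
        exact lintegral_Icc_gaussian_le (norm_pos_iff.2 hv) hcq _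
    _ ≤ ENNReal.ofReal (2 * π) *
          (ENNReal.ofReal (I.toReal + 1) * ENNReal.ofReal (M / (1 + ‖v‖))) := by
        gcongr
        rw [← ENNReal.ofReal_toReal hI.ne]
        exact ENNReal.ofReal_le_ofReal (by simp)
    _ = _ := by
        rw [← ENNReal.ofReal_mul (by positivity), ← ENNReal.ofReal_mul (by positivity)]
        congr 1
        ring

/-- `L^{p₁}_v → L^∞_v` regularization of the integral operator `K`:
`|K h(v)| e^{α|v|²} (1+|v|)^{β₃} ≤ C ‖h‖_{L^{p₁}_{v,α,β₂}}` with
`β₃ = β₂ + 2 − γ − 1/p₁`. -/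
theorem K_Lp_to_Linfty_velocity (γ α β₂ p₁ C₀ α₁ α₂ α₃ : ℝ)
    (hγl : -3 < γ) (hγu : γ ≤ 1) (hα : 0 ≤ α) (hp₁ : 2 ≤ p₁)
    (hp₁' : p₁ / (p₁ - 1) < minExp γ)
    (hC₀ : 0 < C₀) (hα₁ : 0 < α₁) (hα₂ : 0 < α₂) (hα₃ : 0 < α₃)
    (k : E3 → E3 → ℝ) (hmeas : Measurable (Function.uncurry k))
    (hb : ∀ v vs : E3, v ≠ vs →
      |Real.exp (α * ‖v‖ ^ 2) * k v vs * Real.exp (-α * ‖vs‖ ^ 2)| ≤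
        C₀ * wGamma γ ‖v - vs‖ * (1 + ‖v‖ + ‖vs‖) ^ (γ - 1) *
          Real.exp (-α₁ * ‖v - vs‖ ^ 2) *
          Real.exp (-α₃ * (⟪v - vs, v⟫ / ‖v - vs‖ - α₂ * ‖v - vs‖) ^ 2)) :
    ∃ C > (0 : ℝ), ∀ h : E3 → ℝ, Measurable h →
      ∀ᵐ v : E3, ENNReal.ofReal
          (|∫ vs : E3, k v vs * h vs| * Real.exp (α * ‖v‖ ^ 2) *
            (1 + ‖v‖) ^ (β₂ + 2 - γ - 1 / p₁)) ≤
        ENNReal.ofReal C *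
          (∫⁻ vs : E3, ENNReal.ofReal
            (|h vs| ^ p₁ * Real.exp (p₁ * α * ‖vs‖ ^ 2) * (1 + ‖vs‖) ^ (p₁ * β₂))) ^ (1 / p₁) := by
  set q := p₁ / (p₁ - 1) with hqdef
  have hp0 : 0 < p₁ := by linarith
  have hp1 : 0 < p₁ - 1 := by linarith
  have hq0 : 0 < q := by positivity
  have hq2 : q ≤ 2 := by
    rw [hqdef, div_le_iff₀ hp1]
    linarith
  have hpq : q.HolderConjugate p₁ := (Real.HolderConjugate.conjExponent (by linarith)).symm
  obtain ⟨D, hD, hDle⟩ := exists_lintegral_kernel_le (b := α₁) (c := α₃) α₂ hq0 hq2 hp₁'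
    (abs_nonneg (-β₂)) hα₁ hα₃
  refine ⟨C₀ * D ^ (1 / q), by positivity, fun h hh => ?_⟩
  filter_upwards [(Set.countable_singleton (0 : E3)).ae_notMem volume] with v hv
  have hv : v ≠ 0 := by simpa using hv
  have hkm : Measurable (k v) := hmeas.of_uncurry_left
  set A : E3 → ℝ≥0∞ := fun vs => ENNReal.ofReal
    (|exp (α * ‖v‖ ^ 2) * k v vs * exp (-α * ‖vs‖ ^ 2)| * (1 + ‖vs‖) ^ (-β₂)) with hA
  set B : E3 → ℝ≥0∞ := fun vs => ENNReal.ofReal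
    (|h vs| * exp (α * ‖vs‖ ^ 2) * (1 + ‖vs‖) ^ β₂) with hB
  have hAm : Measurable A := by fun_prop
  have hBm : Measurable B := by fun_prop
  have hAB (vs : E3) : ENNReal.ofReal (exp (α * ‖v‖ ^ 2)) * ‖k v vs * h vs‖ₑ = A vs * B vs := by
    rw [hA, hB, Real.enorm_eq_ofReal_abs, ← ENNReal.ofReal_mul (by positivity),
      ← ENNReal.ofReal_mul (by positivity)]
    congr 1
    simp only [abs_mul, abs_exp]
    rw [neg_mul, Real.exp_neg, rpow_neg (by positivity)]
    have : (1 + ‖vs‖) ^ β₂ ≠ 0 := by positivity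
    field_simp
  have hBp : ∫⁻ vs, B vs ^ p₁ = ∫⁻ vs : E3, ENNReal.ofReal
      (|h vs| ^ p₁ * exp (p₁ * α * ‖vs‖ ^ 2) * (1 + ‖vs‖) ^ (p₁ * β₂)) := by
    refine lintegral_congr fun vs => ?_
    rw [hB, ENNReal.ofReal_rpow_of_nonneg (by positivity) hp0.le,
      mul_rpow (by positivity) (by positivity), mul_rpow (by positivity) (by positivity),
      ← exp_mul, ← rpow_mul (by positivity)]
    ring_nf
  set P := C₀ * (1 + ‖v‖) ^ (γ - 1 - β₂) with hP
  have hPpos : 0 < P := by positivity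
  have hAq : ∫⁻ vs, A vs ^ q ≤ ENNReal.ofReal (P ^ q * (D / (1 + ‖v‖))) := by
    set Φ : E3 → ℝ := fun u => wGamma γ ‖u‖ * (1 + ‖u‖) ^ |(-β₂)| * exp (-α₁ * ‖u‖ ^ 2) *
        exp (-α₃ * (⟪u, v⟫ / ‖u‖ - α₂ * ‖u‖) ^ 2) with hΦ
    have hΦ0 (u : E3) : 0 ≤ Φ u := by
      have := wGamma_nonneg γ (norm_nonneg u)
      positivity
    have hle : ∀ᵐ vs : E3, A vs ^ q ≤ ENNReal.ofReal (P ^ q) * ENNReal.ofReal (Φ (v - vs) ^ q) := by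
      filter_upwards [(Set.countable_singleton v).ae_notMem volume] with vs hvs
      have hvs : v ≠ vs := fun h => hvs h.symm
      rw [← ENNReal.ofReal_mul (by positivity), ← mul_rpow hPpos.le (hΦ0 _), hA,
        ENNReal.ofReal_rpow_of_nonneg (by positivity) hq0.le]
      refine ENNReal.ofReal_le_ofReal (rpow_le_rpow (by positivity) ?_ hq0.le)
      have hw := wGamma_nonneg γ (norm_nonneg (v - vs))
      have h1 : (1 + ‖v‖ + ‖vs‖) ^ (γ - 1) ≤ (1 + ‖v‖) ^ (γ - 1) :=
        rpow_le_rpow_of_nonpos (by positivity) (by linarith [norm_nonneg vs]) (by linarith)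
      have h2 : (1 + ‖vs‖) ^ (-β₂) ≤ (1 + ‖v‖) ^ (-β₂) * (1 + ‖v - vs‖) ^ |(-β₂)| := by
        have h3 := norm_le_norm_add_norm_sub v vs
        have h4 := norm_le_norm_add_norm_sub' v vs
        refine rpow_le_rpow_mul_rpow_abs (by positivity) (by positivity) (by positivity) ?_ ?_ _
        · nlinarith [mul_nonneg (norm_nonneg v) (norm_nonneg (v - vs))]
        · nlinarith [mul_nonneg (norm_nonneg vs) (norm_nonneg (v - vs))]
      calc _ ≤ (C₀ * wGamma γ ‖v - vs‖ * (1 + ‖v‖) ^ (γ - 1) * exp (-α₁ * ‖v - vs‖ ^ 2) *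
            exp (-α₃ * (⟪v - vs, v⟫ / ‖v - vs‖ - α₂ * ‖v - vs‖) ^ 2)) *
            ((1 + ‖v‖) ^ (-β₂) * (1 + ‖v - vs‖) ^ |(-β₂)|) := by
            refine mul_le_mul ((hb v vs hvs).trans ?_) h2 (by positivity) (by positivity)
            gcongr
        _ = _ := by
            rw [hP, hΦ, sub_eq_add_neg (γ - 1), rpow_add (by positivity)]
            ring
    calc ∫⁻ vs, A vs ^ q
        ≤ ∫⁻ vs, ENNReal.ofReal (P ^ q) * ENNReal.ofReal (Φ (v - vs) ^ q) := lintegral_mono_ae hle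
      _ = ENNReal.ofReal (P ^ q) * ∫⁻ u, ENNReal.ofReal (Φ u ^ q) := by
          rw [lintegral_const_mul' _ _ ENNReal.ofReal_ne_top,
            lintegral_sub_left_eq_self (fun u => ENNReal.ofReal (Φ u ^ q)) v]
      _ ≤ ENNReal.ofReal (P ^ q) * ENNReal.ofReal (D / (1 + ‖v‖)) := by
          gcongr
          exact hDle v hv
      _ = _ := (ENNReal.ofReal_mul (by positivity)).symm
  set β₃ := β₂ + 2 - γ - 1 / p₁ with hβ₃
  have hconst : (P ^ q * (D / (1 + ‖v‖))) ^ (1 / q) * (1 + ‖v‖) ^ β₃ = C₀ * D ^ (1 / q) := by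
    have hsum : γ - 1 - β₂ - 1 / q + β₃ = 0 := by
      have := hpq.inv_add_inv_eq_one
      rw [hβ₃, one_div, one_div]
      linarith
    have hv1 : 0 < 1 + ‖v‖ := by positivity
    rw [mul_rpow (by positivity) (by positivity), ← rpow_mul hPpos.le,
      mul_one_div_cancel hq0.ne', rpow_one, div_rpow hD.le hv1.le, hP]
    calc _ = C₀ * D ^ (1 / q) *
          ((1 + ‖v‖) ^ (γ - 1 - β₂) / (1 + ‖v‖) ^ (1 / q) * (1 + ‖v‖) ^ β₃) := by ring
      _ = _ := by rw [← rpow_sub hv1, ← rpow_add hv1, hsum, rpow_zero, mul_one]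
  calc ENNReal.ofReal (|∫ vs : E3, k v vs * h vs| * exp (α * ‖v‖ ^ 2) * (1 + ‖v‖) ^ β₃)
      = ENNReal.ofReal (exp (α * ‖v‖ ^ 2)) * ‖∫ vs : E3, k v vs * h vs‖ₑ *
          ENNReal.ofReal ((1 + ‖v‖) ^ β₃) := by
        rw [Real.enorm_eq_ofReal_abs, ← ENNReal.ofReal_mul (by positivity),
          ← ENNReal.ofReal_mul (by positivity), mul_comm (exp _)]
    _ ≤ (ENNReal.ofReal (exp (α * ‖v‖ ^ 2)) * ∫⁻ vs : E3, ‖k v vs * h vs‖ₑ) *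
          ENNReal.ofReal ((1 + ‖v‖) ^ β₃) := by
        gcongr
        exact enorm_integral_le_lintegral_enorm _
    _ = (∫⁻ vs, (A * B) vs) * ENNReal.ofReal ((1 + ‖v‖) ^ β₃) := by
        rw [← lintegral_const_mul' _ _ ENNReal.ofReal_ne_top]
        simp only [hAB, Pi.mul_apply]
    _ ≤ ((∫⁻ vs, A vs ^ q) ^ (1 / q) * (∫⁻ vs, B vs ^ p₁) ^ (1 / p₁)) *
          ENNReal.ofReal ((1 + ‖v‖) ^ β₃) := by
        gcongr
        exact ENNReal.lintegral_mul_le_Lp_mul_Lq volume hpq hAm.aemeasurable hBm.aemeasurable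
    _ ≤ (ENNReal.ofReal (P ^ q * (D / (1 + ‖v‖))) ^ (1 / q) * (∫⁻ vs, B vs ^ p₁) ^ (1 / p₁)) *
          ENNReal.ofReal ((1 + ‖v‖) ^ β₃) := by
        gcongr
    _ = _ := by
        rw [ENNReal.ofReal_rpow_of_nonneg (by positivity) (by positivity), mul_right_comm,
          ← ENNReal.ofReal_mul (by positivity), hconst, hBp]
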